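/- Differentiation under the regularized integral: Let f : ℝ₊² \ {(0,0)} → ℂ be smooth and homogeneous of degree α ∈ ℂ, and a ≥ 0. Then (d/dy) ⨍_a^∞ f(x,y) dx = ⨍_a^∞ ∂_y f(x,y) dx. -/

import Mathlib

open MeasureTheory Filter Asymptotics

noncomputable section

/-- A term `x ^ α * (log x) ^ k` of a partie-finie asymptotic expansion. -/
def CTerm (p : ℂ × ℕ) (x : ℝ) : ℂ :=
  (x : ℂ) ^ p.1 * (Real.log x : ℂ) ^ p.2

/-- Hadamard partie finie regularized limit as `x → ∞`: `g` has an asymptotic expansion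
`g(x) ~ ∑ A p * x ^ p.1 * log x ^ p.2 + c + o(1)` where all expansion terms are
non-decaying and non-constant; `c` is the constant term `a₀₀`. -/
def HasRegLimAtTop (g : ℝ → ℂ) (c : ℂ) : Prop :=
  ∃ (s : Finset (ℂ × ℕ)) (A : ℂ × ℕ → ℂ),
    (∀ p ∈ s, 0 ≤ p.1.re ∧ p ≠ (0, 0)) ∧
    Tendsto (fun x => g x - ∑ p ∈ s, A p * CTerm p x - c) atTop (nhds 0)

/-- Hadamard partie finie regularized limit as `x → 0⁺`. -/
def HasRegLimAtZero (g : ℝ → ℂ) (c : ℂ) : Prop :=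
  ∃ (s : Finset (ℂ × ℕ)) (A : ℂ × ℕ → ℂ),
    (∀ p ∈ s, p.1.re ≤ 0 ∧ p ≠ (0, 0)) ∧
    Tendsto (fun x => g x - ∑ p ∈ s, A p * CTerm p x - c) (nhdsWithin 0 (Set.Ioi 0)) (nhds 0)

/-- `⨍_a^∞ g = v` : the regularized integral of `g` from `a` to `∞` equals `v`.
For `a ≠ 0` it is `LIM_{R→∞} ∫_a^R g`; for `a = 0` one additionally regularizes at the
lower endpoint: `⨍_0^∞ g = LIM_{ε→0} ∫_ε^1 g + LIM_{R→∞} ∫_1^R g`. -/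
def HasRegInt (g : ℝ → ℂ) (a : ℝ) (v : ℂ) : Prop :=
  (a ≠ 0 ∧ HasRegLimAtTop (fun R => ∫ x in a..R, g x) v) ∨
  (a = 0 ∧ ∃ v₀ v₁ : ℂ,
    HasRegLimAtZero (fun e => ∫ x in e..1, g x) v₀ ∧
    HasRegLimAtTop (fun R => ∫ x in (1:ℝ)..R, g x) v₁ ∧ v = v₀ + v₁)

/-- Regularized limit of a sequence (partie finie of the expansion in `N`). -/
def HasRegLimSeq (g : ℕ → ℂ) (c : ℂ) : Prop :=
  ∃ (s : Finset (ℂ × ℕ)) (A : ℂ × ℕ → ℂ),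
    (∀ p ∈ s, 0 ≤ p.1.re ∧ p ≠ (0, 0)) ∧
    Tendsto (fun N : ℕ => g N - ∑ p ∈ s, A p * CTerm p (N : ℝ) - c) atTop (nhds 0)

/-- Regularized sum `Σ-reg_{l=l₀}^∞ g l = v`, the regularized limit of partial sums. -/
def HasRegSum (g : ℕ → ℂ) (l₀ : ℕ) (v : ℂ) : Prop :=
  HasRegLimSeq (fun N => ∑ l ∈ Finset.Icc l₀ N, g l) v

/-- The closed quarter plane minus the origin. -/
def Qset : Set (ℝ × ℝ) := {p | 0 ≤ p.1 ∧ 0 ≤ p.2} \ {0}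

/-- Homogeneity of complex degree `α` on the quarter plane. -/
def Homog (f : ℝ × ℝ → ℂ) (α : ℂ) : Prop :=
  ∀ l : ℝ, 0 < l → ∀ p : ℝ × ℝ, p ∈ Qset →
    f (l * p.1, l * p.2) = (l : ℂ) ^ α * f p

/-- Taylor coefficient `c_j = (∂₁^j f)(0,1)/j!` of the expansion of `f` as `y → ∞`. -/
def cCoef (f : ℝ × ℝ → ℂ) (j : ℕ) : ℂ :=
  (j.factorial : ℂ)⁻¹ * iteratedDerivWithin j (fun t => f (t, 1)) (Set.Ici 0) 0

/-- Taylor coefficient `d_j = (∂₂^j f)(1,0)/j!` of the expansion of `f` as `x → ∞`. -/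
def dCoef (f : ℝ × ℝ → ℂ) (j : ℕ) : ℂ :=
  (j.factorial : ℂ)⁻¹ * iteratedDerivWithin j (fun t => f (1, t)) (Set.Ici 0) 0

open Classical in
/-- `c_{α+1}`: the coefficient `c_j` with `j = α + 1` if `α + 1 ∈ ℕ`, and `0` otherwise. -/
def cCrit (f : ℝ × ℝ → ℂ) (α : ℂ) : ℂ :=
  if h : ∃ j : ℕ, α + 1 = (j : ℂ) then cCoef f h.choose else 0

open Classical in
/-- `d_{α+1}`: the coefficient `d_j` with `j = α + 1` if `α + 1 ∈ ℕ`, and `0` otherwise. -/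
def dCrit (f : ℝ × ℝ → ℂ) (α : ℂ) : ℂ :=
  if h : ∃ j : ℕ, α + 1 = (j : ℂ) then dCoef f h.choose else 0

end

open Polynomial in
/-- A polynomial that tends to zero along the positive real axis is zero. -/
theorem polynomial_eq_zero_of_tendsto {P : Polynomial ℂ}
    (h : Tendsto (fun t : ℝ => P.eval (t : ℂ)) atTop (nhds 0)) : P = 0 := by
  rcases lt_or_ge 0 P.degree with hd | hd
  · have hz : Tendsto (fun t : ℝ => ‖(t : ℂ)‖) atTop atTop := by
      simpa using tendsto_abs_atTop_atTop (G := ℝ)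
    exact absurd h.norm (not_tendsto_nhds_of_tendsto_atTop (P.tendsto_norm_atTop hd hz) _)
  · rw [eq_C_of_degree_le_zero hd] at h ⊢
    simp only [eval_C] at h
    simp [tendsto_nhds_unique tendsto_const_nhds h]

/-- For `z ≠ 0` some real translation acts non-trivially on `t ↦ exp (z * t)`. -/
theorem exists_exp_mul_ne_one {z : ℂ} (hz : z ≠ 0) : ∃ τ : ℝ, Complex.exp (z * τ) ≠ 1 := by
  by_contra! h
  have h1 : HasDerivAt (fun t : ℝ => Complex.exp (z * t)) (Complex.exp (z * (0 : ℝ)) * (z * 1)) 0 :=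
    ((hasDerivAt_id (0 : ℝ)).ofReal_comp.const_mul z).cexp
  simp only [h] at h1
  exact hz (by simpa using h1.unique (hasDerivAt_const _ _))

open Polynomial in
/-- If an exponential polynomial tends to zero at infinity, then the polynomial attached to the
zero exponent vanishes. -/
theorem polynomial_eq_zero_of_tendsto_expPoly (Z : Finset ℂ) (hZ : (0 : ℂ) ∉ Z)
    (P : Polynomial ℂ) (Q : ℂ → Polynomial ℂ)
    (h : Tendsto (fun t : ℝ => P.eval (t : ℂ) +
      ∑ z ∈ Z, Complex.exp (z * t) * (Q z).eval (t : ℂ)) atTop (nhds 0)) : P = 0 := by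
  classical
  induction Z using Finset.induction_on generalizing P Q with
  | empty => exact polynomial_eq_zero_of_tendsto (by simpa using h)
  | insert z Z hzZ ih =>
    have hz : z ≠ 0 := fun h0 => hZ (by simp [h0])
    have hZ' : (0 : ℂ) ∉ Z := fun h0 => hZ (by simp [h0])
    obtain ⟨τ, hτ⟩ := exists_exp_mul_ne_one hz
    obtain ⟨m, hm⟩ : ∃ m : ℕ, (Q z).degree < m := ⟨(Q z).natDegree + 1, by
      exact_mod_cast (degree_le_natDegree).trans_lt (by exact_mod_cast Nat.lt_succ_self _)⟩
    induction m generalizing P Q with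
    | zero =>
      have hQ : Q z = 0 := by
        rw [← degree_eq_bot]
        simpa using Nat.WithBot.lt_zero_iff.1 hm
      refine ih hZ' P Q ?_
      simpa [Finset.sum_insert hzZ, hQ] using h
    | succ m ihm =>
      set w := Complex.exp (z * τ) with hw
      have key : taylor (τ : ℂ) P - C w * P = 0 := by
        refine ihm _ (fun u => C (Complex.exp (u * τ)) * taylor (τ : ℂ) (Q u) - C w * Q u) ?_ ?_
        · have h1 := (h.comp (tendsto_atTop_add_const_right atTop τ tendsto_id)).sub
            (h.const_mul w)
          simp only [mul_zero, sub_zero] at h1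
          refine h1.congr fun t => ?_
          simp only [Function.comp_apply, id, eval_sub, eval_mul, eval_C, taylor_eval,
            Complex.ofReal_add, mul_add, Complex.exp_add, Finset.mul_sum]
          rw [add_sub_add_comm, ← Finset.sum_sub_distrib]
          congr 1
          exact Finset.sum_congr rfl fun u _ => by ring
        · rw [← hw, ← mul_sub, degree_C_mul (Complex.exp_ne_zero _)]
          by_cases hQ : Q z = 0
          · simp [hQ]
          · have h2 := degree_sub_lt_right (degree_taylor (Q z) (τ : ℂ)) hQ
              (leadingCoeff_taylor _ _)
            have h3 : (Q z).degree ≤ m := Order.lt_succ_iff.1 (by exact_mod_cast hm)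
            exact h2.trans_le h3
      have hl := congrArg leadingCoeff (sub_eq_zero.1 key)
      rw [leadingCoeff_taylor, leadingCoeff_mul, leadingCoeff_C] at hl
      by_contra hP
      have := leadingCoeff_ne_zero.2 hP
      exact hτ (mul_right_cancel₀ this (by rw [← hl, one_mul]))

/-- The exponential polynomial `∑ exp (z * t) * q_z(t)` encoded by a finitely supported family
of polynomials. -/
noncomputable def expPolyEval (Q : ℂ →₀ Polynomial ℂ) (t : ℝ) : ℂ :=
  Q.sum fun z q => Complex.exp (z * t) * q.eval (t : ℂ)

theorem expPolyEval_add (Q Q' : ℂ →₀ Polynomial ℂ) (t : ℝ) :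
    expPolyEval (Q + Q') t = expPolyEval Q t + expPolyEval Q' t :=
  Finsupp.sum_add_index' (by simp) (by simp [mul_add])

theorem expPolyEval_single (z : ℂ) (q : Polynomial ℂ) (t : ℝ) :
    expPolyEval (Finsupp.single z q) t = Complex.exp (z * t) * q.eval (t : ℂ) :=
  Finsupp.sum_single_index (by simp)

theorem apply_zero_eq_zero_of_tendsto_expPolyEval {Q : ℂ →₀ Polynomial ℂ}
    (h : Tendsto (expPolyEval Q) atTop (nhds 0)) : Q 0 = 0 := by
  classical
  refine polynomial_eq_zero_of_tendsto_expPoly (Q.support.erase 0) (by simp) (Q 0) Q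
    (h.congr fun t => ?_)
  by_cases h0 : (0 : ℂ) ∈ Q.support
  · rw [expPolyEval, Finsupp.sum, ← Finset.add_sum_erase _ _ h0]
    simp
  · rw [Finset.erase_eq_of_notMem h0, Finsupp.notMem_support_iff.1 h0]
    simp [expPolyEval, Finsupp.sum]

/-- `g` has, in the variable `t = log x`, an expansion by an exponential polynomial whose
constant term is `c`. -/
def HasExpPolyLim (g : ℝ → ℂ) (c : ℂ) : Prop :=
  ∃ Q : ℂ →₀ Polynomial ℂ, (Q 0).coeff 0 = c ∧
    Tendsto (fun t => g (Real.exp t) - expPolyEval Q t) atTop (nhds 0)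

namespace HasExpPolyLim

theorem add {g g' : ℝ → ℂ} {c c' : ℂ} (h : HasExpPolyLim g c) (h' : HasExpPolyLim g' c') :
    HasExpPolyLim (fun x => g x + g' x) (c + c') := by
  obtain ⟨Q, rfl, hQ⟩ := h
  obtain ⟨Q', rfl, hQ'⟩ := h'
  refine ⟨Q + Q', by simp, ?_⟩
  have := hQ.add hQ'
  rw [add_zero] at this
  refine this.congr fun t => ?_
  rw [expPolyEval_add]
  ring

theorem congr' {g g' : ℝ → ℂ} {c : ℂ} (h : HasExpPolyLim g c) (hg : g =ᶠ[atTop] g') :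
    HasExpPolyLim g' c := by
  obtain ⟨Q, hc, hQ⟩ := h
  refine ⟨Q, hc, hQ.congr' ?_⟩
  filter_upwards [Real.tendsto_exp_atTop.eventually hg] with t ht
  rw [ht]

theorem of_tendsto {g : ℝ → ℂ} {c : ℂ} (h : Tendsto g atTop (nhds c)) : HasExpPolyLim g c := by
  refine ⟨Finsupp.single 0 (Polynomial.C c), by simp, ?_⟩
  simpa [expPolyEval_single] using (h.comp Real.tendsto_exp_atTop).sub_const c

theorem of_single {g : ℝ → ℂ} {z b : ℂ} {k : ℕ} (hzk : (z, k) ≠ (0, 0))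
    (hg : ∀ t : ℝ, g (Real.exp t) = b * (Complex.exp (z * t) * (t : ℂ) ^ k)) :
    HasExpPolyLim g 0 := by
  refine ⟨Finsupp.single z (Polynomial.monomial k b), ?_, ?_⟩
  · by_cases hz : z = 0
    · have hk : k ≠ 0 := fun hk => hzk (by simp [hz, hk])
      simp [hz, Polynomial.coeff_monomial, hk]
    · simp [hz]
  · refine tendsto_const_nhds.congr fun t => ?_
    rw [hg, expPolyEval_single, Polynomial.eval_monomial]
    ring

theorem sum {ι : Type*} (s : Finset ι) {g : ι → ℝ → ℂ} {c : ι → ℂ}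
    (h : ∀ i ∈ s, HasExpPolyLim (g i) (c i)) :
    HasExpPolyLim (fun x => ∑ i ∈ s, g i x) (∑ i ∈ s, c i) := by
  classical
  induction s using Finset.induction_on with
  | empty => simpa using of_tendsto tendsto_const_nhds
  | insert i s hi ih =>
    simp only [Finset.sum_insert hi]
    exact (h i (by simp)).add (ih fun j hj => h j (by simp [hj]))

theorem const_mul {g : ℝ → ℂ} {c : ℂ} (h : HasExpPolyLim g c) (b : ℂ) :
    HasExpPolyLim (fun x => b * g x) (b * c) := by
  obtain ⟨Q, rfl, hQ⟩ := h
  refine ⟨b • Q, by simp, ?_⟩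
  have := hQ.const_mul b
  rw [mul_zero] at this
  refine this.congr fun t => ?_
  have : expPolyEval (b • Q) t = b * expPolyEval Q t := by
    rw [expPolyEval, Finsupp.sum_smul_index' (by simp), expPolyEval, Finsupp.mul_sum]
    refine Finsupp.sum_congr fun z _ => ?_
    rw [Polynomial.eval_smul, smul_eq_mul]
    ring
  rw [this]
  ring

theorem unique {g : ℝ → ℂ} {c c' : ℂ} (h : HasExpPolyLim g c) (h' : HasExpPolyLim g c') :
    c = c' := by
  obtain ⟨Q, hc, hQ⟩ := h.add (h'.const_mul (-1))
  have hQ0 : Tendsto (expPolyEval Q) atTop (nhds 0) := by simpa using hQ.neg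
  rw [apply_zero_eq_zero_of_tendsto_expPolyEval hQ0] at hc
  simp only [Polynomial.coeff_zero] at hc
  linear_combination -hc

end HasExpPolyLim

theorem cpow_exp_ofReal (t : ℝ) (z : ℂ) :
    ((Real.exp t : ℝ) : ℂ) ^ z = Complex.exp (z * t) := by
  rw [Complex.cpow_def_of_ne_zero (by exact_mod_cast (Real.exp_pos t).ne'),
    ← Complex.ofReal_log (Real.exp_pos t).le, Real.log_exp, mul_comm]

theorem CTerm_exp (p : ℂ × ℕ) (t : ℝ) :
    CTerm p (Real.exp t) = Complex.exp (p.1 * t) * (t : ℂ) ^ p.2 := by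
  rw [CTerm, cpow_exp_ofReal, Real.log_exp]

theorem HasRegLimAtTop.hasExpPolyLim {g : ℝ → ℂ} {c : ℂ} (h : HasRegLimAtTop g c) :
    HasExpPolyLim g c := by
  obtain ⟨s, A, hs, hlim⟩ := h
  have h1 : HasExpPolyLim (fun x => ∑ p ∈ s, A p * CTerm p x) (∑ p ∈ s, 0) :=
    HasExpPolyLim.sum s fun p hp => .of_single (hs p hp).2 fun t => by rw [CTerm_exp]
  have h2 := h1.add (HasExpPolyLim.of_tendsto (hlim.add_const c))
  simp only [Finset.sum_const_zero, zero_add] at h2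
  exact h2.congr' (Eventually.of_forall fun x => by ring)

theorem HasRegLimAtZero.hasExpPolyLim {g : ℝ → ℂ} {c : ℂ} (h : HasRegLimAtZero g c) :
    HasExpPolyLim (fun x => g x⁻¹) c := by
  obtain ⟨s, A, hs, hlim⟩ := h
  have h1 : HasExpPolyLim (fun x => ∑ p ∈ s, A p * CTerm p x⁻¹) (∑ p ∈ s, 0) := by
    refine HasExpPolyLim.sum s fun p hp =>
      .of_single (z := -p.1) (k := p.2) (b := A p * (-1) ^ p.2) ?_ fun t => ?_
    · have := (hs p hp).2
      contrapose! this
      simp only [Prod.mk.injEq, neg_eq_zero] at this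
      exact Prod.ext this.1 this.2
    · rw [← Real.exp_neg, CTerm_exp, Complex.ofReal_neg, neg_pow (t : ℂ), mul_neg, neg_mul]
      ring
  have h2 := h1.add (HasExpPolyLim.of_tendsto
    ((hlim.comp tendsto_inv_atTop_nhdsGT_zero).add_const c))
  simp only [Finset.sum_const_zero, zero_add] at h2
  exact h2.congr' (Eventually.of_forall fun x => by simp [Function.comp])

theorem exists_hasExpPolyLim_integral_cpow {a : ℝ} (ha : 0 < a) (β : ℂ) :
    ∃ P, HasExpPolyLim (fun R => ∫ x in a..R, (x : ℂ) ^ β) P := by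
  have hmem : ∀ R : ℝ, 0 < R → (0 : ℝ) ∉ Set.uIcc a R := fun R hR h0 =>
    absurd h0.1 (not_le.2 (lt_min ha hR))
  by_cases hβ : β = -1
  · have h1 : HasExpPolyLim (fun R => (Real.log R : ℂ)) 0 :=
      .of_single (z := 0) (k := 1) (b := 1) (by simp) fun t => by simp
    refine ⟨_, (h1.add (.of_tendsto (tendsto_const_nhds (x := -(Real.log a : ℂ))))).congr' ?_⟩
    filter_upwards [eventually_gt_atTop 0] with R hR
    subst hβ
    have h2 : ∫ x in a..R, (x : ℂ) ^ (-1 : ℂ) = ((∫ x in a..R, x⁻¹ : ℝ) : ℂ) := by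
      rw [← intervalIntegral.integral_ofReal]
      simp [Complex.cpow_neg_one]
    rw [h2, integral_inv (hmem R hR), Real.log_div hR.ne' ha.ne']
    push_cast
    ring
  · have hβ' : β + 1 ≠ 0 := fun h => hβ (by linear_combination h)
    have h1 : HasExpPolyLim (fun R => (β + 1)⁻¹ * (R : ℂ) ^ (β + 1)) 0 :=
      .of_single (z := β + 1) (k := 0) (b := (β + 1)⁻¹) (by simpa using hβ') fun t => by
        rw [cpow_exp_ofReal]; simp
    refine ⟨_, (h1.add (.of_tendsto (tendsto_const_nhds
      (x := -((β + 1)⁻¹ * (a : ℂ) ^ (β + 1)))))).congr' ?_⟩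
    filter_upwards [eventually_gt_atTop 0] with R hR
    rw [integral_cpow (Or.inr ⟨hβ, hmem R hR⟩)]
    ring

/-- The regularized integral of a finite sum of powers plus an integrable remainder. -/
theorem hasExpPolyLim_integral_of_eq_sum_add {a : ℝ} (ha : 0 < a) {s : Finset ℕ} {c β P : ℕ → ℂ}
    (hP : ∀ j, HasExpPolyLim (fun R => ∫ x in a..R, (x : ℂ) ^ β j) (P j))
    {g h : ℝ → ℂ} (hh : IntegrableOn h (Set.Ioi a))
    (hg : ∀ x, a < x → g x = ∑ j ∈ s, c j * (x : ℂ) ^ β j + h x) :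
    HasExpPolyLim (fun R => ∫ x in a..R, g x) (∑ j ∈ s, c j * P j + ∫ x in Set.Ioi a, h x) := by
  have h1 := (HasExpPolyLim.sum s fun j _ => (hP j).const_mul (c j)).add
    (.of_tendsto (intervalIntegral_tendsto_integral_Ioi a hh tendsto_id))
  refine h1.congr' ?_
  filter_upwards [eventually_gt_atTop a] with R hR
  have hint : ∀ j, IntervalIntegrable (fun x : ℝ => c j * (x : ℂ) ^ β j) volume a R := fun j =>
    (intervalIntegral.intervalIntegrable_cpow (Or.inr fun h0 =>
      absurd h0.1 (not_le.2 (lt_min ha (ha.trans hR))))).const_mul _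
  have hint' : IntervalIntegrable h volume a R :=
    (intervalIntegrable_iff_integrableOn_Ioc_of_le hR.le).2
      (hh.mono_set Set.Ioc_subset_Ioi_self)
  have h2 : ∫ x in a..R, g x = ∫ x in a..R, (∑ j ∈ s, c j * (x : ℂ) ^ β j) + h x := by
    refine intervalIntegral.integral_congr_ae (ae_of_all _ fun x hx => hg x ?_)
    rw [Set.uIoc_of_le hR.le] at hx
    exact hx.1
  have h3 : IntervalIntegrable (fun x : ℝ => ∑ j ∈ s, c j * (x : ℂ) ^ β j) volume a R := by
    simpa [Finset.sum_fn] using IntervalIntegrable.sum s fun j _ => hint j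
  rw [h2, intervalIntegral.integral_add h3 hint',
    intervalIntegral.integral_finsetSum fun j _ => hint j]
  simp

theorem hasDerivWithinAt_derivWithin_Ici {φ : ℝ → ℂ}
    (hφ : ContDiffOn ℝ (⊤ : ℕ∞) φ (Set.Ici 0)) {t : ℝ} (ht : 0 ≤ t) :
    HasDerivWithinAt φ (derivWithin φ (Set.Ici 0) t) (Set.Ici 0) t :=
  (hφ.differentiableOn (by simp) t ht).hasDerivWithinAt

theorem hasDerivAt_derivWithin_Ici {φ : ℝ → ℂ}
    (hφ : ContDiffOn ℝ (⊤ : ℕ∞) φ (Set.Ici 0)) {t : ℝ} (ht : 0 < t) :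
    HasDerivAt φ (derivWithin φ (Set.Ici 0) t) t :=
  (hasDerivWithinAt_derivWithin_Ici hφ ht.le).hasDerivAt (Ici_mem_nhds ht)

theorem contDiffOn_derivWithin_Ici {φ : ℝ → ℂ}
    (hφ : ContDiffOn ℝ (⊤ : ℕ∞) φ (Set.Ici 0)) :
    ContDiffOn ℝ (⊤ : ℕ∞) (derivWithin φ (Set.Ici 0)) (Set.Ici 0) :=
  hφ.derivWithin (uniqueDiffOn_Ici 0) (by norm_cast)

theorem hasDerivAt_sum_mul_pow (s : Finset ℕ) (d : ℕ → ℂ) (t : ℝ) :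
    HasDerivAt (fun t : ℝ => ∑ j ∈ s, d j * (t : ℂ) ^ j)
      (∑ j ∈ s, d j * (j * (t : ℂ) ^ (j - 1))) t := by
  refine HasDerivAt.fun_sum fun j _ => ?_
  simpa using ((hasDerivAt_id t).ofReal_comp.pow j).const_mul (d j)

/-- A polynomial approximation of the derivative integrates to one of the function. -/
theorem exists_taylor_bound_of_derivWithin {φ : ℝ → ℂ}
    (hφ : ContDiffOn ℝ (⊤ : ℕ∞) φ (Set.Ici 0)) {T C : ℝ} (hC : 0 ≤ C) {m : ℕ} {e : ℕ → ℂ}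
    (he : ∀ t ∈ Set.Icc 0 T, ‖derivWithin φ (Set.Ici 0) t -
      ∑ j ∈ Finset.range m, e j * (t : ℂ) ^ j‖ ≤ C * t ^ m) :
    ∃ d : ℕ → ℂ, ∀ t ∈ Set.Icc 0 T,
      ‖φ t - ∑ j ∈ Finset.range (m + 1), d j * (t : ℂ) ^ j‖ ≤ C * t ^ (m + 1) ∧
      ‖derivWithin φ (Set.Ici 0) t -
        ∑ j ∈ Finset.range (m + 1), d j * (j * (t : ℂ) ^ (j - 1))‖ ≤ C * t ^ m := by
  set d : ℕ → ℂ := fun j => if j = 0 then φ 0 else e (j - 1) / j with hd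
  have hsum : ∀ t : ℝ, ∑ j ∈ Finset.range (m + 1), d j * (j * (t : ℂ) ^ (j - 1)) =
      ∑ j ∈ Finset.range m, e j * (t : ℂ) ^ j := fun t => by
    rw [Finset.sum_range_succ']
    simp only [hd, Nat.cast_zero, zero_mul, mul_zero, add_zero, Nat.succ_ne_zero, if_false,
      Nat.add_sub_cancel]
    refine Finset.sum_congr rfl fun j _ => ?_
    have : ((j + 1 : ℕ) : ℂ) ≠ 0 := Nat.cast_ne_zero.2 j.succ_ne_zero
    field_simp
  refine ⟨d, fun t ht => ⟨?_, by rw [hsum]; exact he t ht⟩⟩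
  have hmv := (convex_Icc (0 : ℝ) t).norm_image_sub_le_of_norm_hasDerivWithin_le
    (f := fun u : ℝ => φ u - ∑ j ∈ Finset.range (m + 1), d j * (u : ℂ) ^ j)
    (f' := fun u => derivWithin φ (Set.Ici 0) u -
      ∑ j ∈ Finset.range (m + 1), d j * (j * (u : ℂ) ^ (j - 1))) (C := C * t ^ m)
    (fun u hu => ((hasDerivWithinAt_derivWithin_Ici hφ hu.1).mono Set.Icc_subset_Ici_self).sub
      (hasDerivAt_sum_mul_pow _ d u).hasDerivWithinAt)
    (fun u hu => by
      rw [hsum]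
      refine (he u ⟨hu.1, hu.2.trans ht.2⟩).trans ?_
      have := hu.1
      gcongr
      exact hu.2)
    (Set.left_mem_Icc.2 ht.1) (Set.right_mem_Icc.2 ht.1)
  have h0 : φ 0 - ∑ j ∈ Finset.range (m + 1), d j * ((0 : ℝ) : ℂ) ^ j = 0 := by
    rw [Finset.sum_range_succ']
    simp [hd]
  simp only [h0, sub_zero, Real.norm_of_nonneg ht.1] at hmv
  rwa [pow_succ, ← mul_assoc]

theorem exists_taylor_bound (T : ℝ) (m : ℕ) {φ : ℝ → ℂ}
    (hφ : ContDiffOn ℝ (⊤ : ℕ∞) φ (Set.Ici 0)) :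
    ∃ (d : ℕ → ℂ) (C : ℝ), 0 ≤ C ∧ ∀ t ∈ Set.Icc 0 T,
      ‖φ t - ∑ j ∈ Finset.range m, d j * (t : ℂ) ^ j‖ ≤ C * t ^ m := by
  induction m generalizing φ with
  | zero =>
    obtain ⟨C, hC⟩ := (isCompact_Icc (a := (0 : ℝ)) (b := T)).exists_bound_of_continuousOn
      (hφ.continuousOn.mono Set.Icc_subset_Ici_self)
    exact ⟨0, max C 0, le_max_right _ _, fun t ht => by simpa using Or.inl (hC t ht)⟩
  | succ m ih =>
    obtain ⟨e, C, hC, he⟩ := ih (contDiffOn_derivWithin_Ici hφ)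
    obtain ⟨d, hd⟩ := exists_taylor_bound_of_derivWithin hφ hC he
    exact ⟨d, C, hC, fun t ht => (hd t ht).1⟩

theorem exists_taylor_bound_deriv (T : ℝ) (m : ℕ) {φ : ℝ → ℂ}
    (hφ : ContDiffOn ℝ (⊤ : ℕ∞) φ (Set.Ici 0)) :
    ∃ (d : ℕ → ℂ) (C : ℝ), 0 ≤ C ∧ ∀ t ∈ Set.Icc 0 T,
      ‖φ t - ∑ j ∈ Finset.range (m + 1), d j * (t : ℂ) ^ j‖ ≤ C * t ^ (m + 1) ∧
      ‖derivWithin φ (Set.Ici 0) t -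
        ∑ j ∈ Finset.range (m + 1), d j * (j * (t : ℂ) ^ (j - 1))‖ ≤ C * t ^ m := by
  obtain ⟨e, C, hC, he⟩ := exists_taylor_bound T m (contDiffOn_derivWithin_Ici hφ)
  obtain ⟨d, hd⟩ := exists_taylor_bound_of_derivWithin hφ hC he
  exact ⟨d, C, hC, hd⟩

theorem Homog.eq_cpow_mul_left {f : ℝ × ℝ → ℂ} {α : ℂ} (hf : Homog f α) {x y : ℝ}
    (hx : 0 < x) (hy : 0 ≤ y) : f (x, y) = (x : ℂ) ^ α * f (1, y / x) := by
  have := hf x hx (1, y / x) ⟨⟨zero_le_one, div_nonneg hy hx.le⟩, by simp⟩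
  rwa [mul_one, mul_div_cancel₀ _ hx.ne'] at this

theorem Homog.eq_cpow_mul_right {f : ℝ × ℝ → ℂ} {α : ℂ} (hf : Homog f α) {x y : ℝ}
    (hx : 0 ≤ x) (hy : 0 < y) : f (x, y) = (y : ℂ) ^ α * f (x / y, 1) := by
  have := hf y hy (x / y, 1) ⟨⟨div_nonneg hx hy.le, zero_le_one⟩, by simp⟩
  rwa [mul_one, mul_div_cancel₀ _ hy.ne'] at this

theorem contDiffOn_snd_of_Qset {f : ℝ × ℝ → ℂ} (hf : ContDiffOn ℝ (⊤ : ℕ∞) f Qset) :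
    ContDiffOn ℝ (⊤ : ℕ∞) (fun t => f (1, t)) (Set.Ici 0) :=
  hf.comp (contDiff_const.prodMk contDiff_id).contDiffOn
    fun _ ht => ⟨⟨zero_le_one, ht⟩, by simp⟩

theorem contDiffOn_fst_of_Qset {f : ℝ × ℝ → ℂ} (hf : ContDiffOn ℝ (⊤ : ℕ∞) f Qset) :
    ContDiffOn ℝ (⊤ : ℕ∞) (fun t => f (t, 1)) (Set.Ici 0) :=
  hf.comp (contDiff_id.prodMk contDiff_const).contDiffOn
    fun _ ht => ⟨⟨ht, zero_le_one⟩, by simp⟩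

/-- Differentiation of `y ↦ ∫_{x > a} x ^ α * ψ (y / x)` for `ψ` vanishing to high order at `0`. -/
theorem hasDerivAt_integral_Ioi_cpow_mul {a y₀ C : ℝ} (ha : 0 < a) (hy₀ : 0 < y₀) (hC : 0 ≤ C)
    {α : ℂ} {m : ℕ} (hm : α.re < m) {ψ ψ' : ℝ → ℂ}
    (hψ : ∀ t, 0 < t → HasDerivAt ψ (ψ' t) t) (hψ' : ContinuousOn ψ' (Set.Ioi 0))
    (hb : ∀ t ∈ Set.Ioc 0 (2 * y₀ / a), ‖ψ t‖ ≤ C * t ^ (m + 1) ∧ ‖ψ' t‖ ≤ C * t ^ m) :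
    (∀ y ∈ Set.Ioo 0 (2 * y₀),
      IntegrableOn (fun x : ℝ => (x : ℂ) ^ α * ψ (y / x)) (Set.Ioi a)) ∧
    IntegrableOn (fun x : ℝ => (x : ℂ) ^ (α - 1) * ψ' (y₀ / x)) (Set.Ioi a) ∧
    HasDerivAt (fun y => ∫ x in Set.Ioi a, (x : ℂ) ^ α * ψ (y / x))
      (∫ x in Set.Ioi a, (x : ℂ) ^ (α - 1) * ψ' (y₀ / x)) y₀ := by
  have hψc : ContinuousOn ψ (Set.Ioi 0) := fun t ht => (hψ t ht).continuousAt.continuousWithinAt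
  have hmeas : ∀ {χ : ℝ → ℂ} (_ : ContinuousOn χ (Set.Ioi 0)) (β : ℂ) {y : ℝ}, 0 < y →
      AEStronglyMeasurable (fun x : ℝ => (x : ℂ) ^ β * χ (y / x))
        (volume.restrict (Set.Ioi a)) := by
    intro χ hχ β y hy
    refine ContinuousOn.aestronglyMeasurable (fun x hx => ?_) measurableSet_Ioi
    have hx0 : 0 < x := ha.trans hx
    refine ContinuousAt.continuousWithinAt (ContinuousAt.mul ?_ ?_)
    · exact Complex.continuousAt_ofReal_cpow_const _ _ (Or.inr hx0.ne')
    · exact ContinuousAt.comp (f := fun x => y / x)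
        (hχ.continuousAt (Ioi_mem_nhds (div_pos hy hx0)))
        (continuousAt_const.div continuousAt_id hx0.ne')
  have hquot : ∀ {x y : ℝ}, a < x → y ∈ Set.Ioo 0 (2 * y₀) →
      y / x ∈ Set.Ioc 0 (2 * y₀ / a) := fun {x y} hx hy => by
    have hx0 : 0 < x := ha.trans hx
    have h2 : 0 ≤ 2 * y₀ := by positivity
    exact ⟨div_pos hy.1 hx0, div_le_div₀ h2 hy.2.le ha hx.le⟩
  have hnorm : ∀ {x y : ℝ} {β v : ℂ} {k : ℕ}, a < x → y ∈ Set.Ioo 0 (2 * y₀) →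
      ‖v‖ ≤ C * (y / x) ^ k →
      ‖(x : ℂ) ^ β * v‖ ≤ C * (2 * y₀) ^ k * x ^ (β.re - k) := by
    intro x y β v k hx hy hv
    have hx0 : 0 < x := ha.trans hx
    have hy0 := hy.1
    rw [norm_mul, Complex.norm_cpow_eq_rpow_re_of_pos hx0, Real.rpow_sub_natCast hx0.ne']
    calc x ^ β.re * ‖v‖ ≤ x ^ β.re * (C * (y / x) ^ k) := by gcongr
      _ = C * y ^ k * (x ^ β.re / x ^ k) := by rw [div_pow]; ring
      _ ≤ C * (2 * y₀) ^ k * (x ^ β.re / x ^ k) := by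
        have := hy.2.le
        gcongr
  have hre : (α - 1).re - m = α.re - (m + 1 : ℕ) := by
    rw [Complex.sub_re, Complex.one_re]; push_cast; ring
  have hpow : IntegrableOn (fun x : ℝ => x ^ (α.re - (m + 1 : ℕ))) (Set.Ioi a) :=
    integrableOn_Ioi_rpow_of_lt (by push_cast; linarith) ha
  have hbound : ∀ y ∈ Set.Ioo 0 (2 * y₀), ∀ x ∈ Set.Ioi a,
      ‖(x : ℂ) ^ (α - 1) * ψ' (y / x)‖ ≤ C * (2 * y₀) ^ m * x ^ (α.re - (m + 1 : ℕ)) :=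
    fun y hy x hx => by
      rw [← hre]
      exact hnorm hx hy (hb _ (hquot hx hy)).2
  have hint : ∀ y ∈ Set.Ioo 0 (2 * y₀),
      IntegrableOn (fun x : ℝ => (x : ℂ) ^ α * ψ (y / x)) (Set.Ioi a) := fun y hy =>
    (hpow.const_mul (C * (2 * y₀) ^ (m + 1))).mono' (hmeas hψc α hy.1)
      ((ae_restrict_iff' measurableSet_Ioi).2 <| ae_of_all _ fun x hx =>
        hnorm hx hy (hb _ (hquot hx hy)).1)
  have hy₀m : y₀ ∈ Set.Ioo 0 (2 * y₀) := ⟨hy₀, by linarith⟩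
  refine ⟨hint, ?_⟩
  refine hasDerivAt_integral_of_dominated_loc_of_deriv_le
    (F := fun y x => (x : ℂ) ^ α * ψ (y / x))
    (F' := fun y x => (x : ℂ) ^ (α - 1) * ψ' (y / x)) (s := Set.Ioo 0 (2 * y₀))
    (bound := fun x => C * (2 * y₀) ^ m * x ^ (α.re - (m + 1 : ℕ)))
    (Ioo_mem_nhds hy₀m.1 hy₀m.2) ?_ (hint _ hy₀m) (hmeas hψ' _ hy₀)
    ((ae_restrict_iff' measurableSet_Ioi).2 <| ae_of_all _ fun x hx y hy => hbound y hy x hx)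
    (hpow.const_mul _)
    ((ae_restrict_iff' measurableSet_Ioi).2 <| ae_of_all _ fun x hx y hy => ?_)
  · filter_upwards [Ioi_mem_nhds hy₀] with y hy using hmeas hψc α hy
  · have hx0 : 0 < x := ha.trans hx
    have h1 := ((hψ (y / x) (div_pos hy.1 hx0)).scomp y
      ((hasDerivAt_id y).div_const x)).const_mul ((x : ℂ) ^ α)
    refine h1.congr_deriv ?_
    have hxc : (x : ℂ) ≠ 0 := by exact_mod_cast hx0.ne'
    rw [Complex.cpow_sub _ _ hxc, Complex.cpow_one, Complex.real_smul]
    push_cast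
    field_simp

theorem exists_hasExpPolyLim_integral_top {f : ℝ × ℝ → ℂ} {α : ℂ}
    (hsm : ContDiffOn ℝ (⊤ : ℕ∞) f Qset) (hhom : Homog f α) {a y₀ : ℝ} (ha : 0 < a)
    (hy₀ : 0 < y₀) :
    ∃ (F : ℝ → ℂ) (G : ℂ),
      (∀ y ∈ Set.Ioo 0 (2 * y₀), HasExpPolyLim (fun R => ∫ x in a..R, f (x, y)) (F y)) ∧
      HasExpPolyLim (fun R => ∫ x in a..R, deriv (fun t => f (x, t)) y₀) G ∧
      HasDerivAt F G y₀ := by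
  obtain ⟨m, hm⟩ := exists_nat_gt α.re
  have hφ := contDiffOn_snd_of_Qset hsm
  obtain ⟨d, C, hC, hd⟩ := exists_taylor_bound_deriv (2 * y₀ / a) m hφ
  choose P hP using fun j : ℕ => exists_hasExpPolyLim_integral_cpow ha (α - j)
  set ψ : ℝ → ℂ := fun t => f (1, t) - ∑ j ∈ Finset.range (m + 1), d j * (t : ℂ) ^ j with hψdef
  set ψ' : ℝ → ℂ := fun t => derivWithin (fun t => f (1, t)) (Set.Ici 0) t -
    ∑ j ∈ Finset.range (m + 1), d j * (j * (t : ℂ) ^ (j - 1))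
  have hψ : ∀ t, 0 < t → HasDerivAt ψ (ψ' t) t := fun t ht =>
    (hasDerivAt_derivWithin_Ici hφ ht).sub (hasDerivAt_sum_mul_pow _ d t)
  have hψ' : ContinuousOn ψ' (Set.Ioi 0) := by
    refine ((contDiffOn_derivWithin_Ici hφ).continuousOn.mono Set.Ioi_subset_Ici_self).sub ?_
    fun_prop
  obtain ⟨hint, hint', hder⟩ := hasDerivAt_integral_Ioi_cpow_mul ha hy₀ hC hm hψ hψ'
    fun t ht => hd t ⟨ht.1.le, ht.2⟩
  have hf : ∀ x, a < x → ∀ y, 0 < y → f (x, y) =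
      ∑ j ∈ Finset.range (m + 1), d j * (y : ℂ) ^ j * (x : ℂ) ^ (α - j) +
        (x : ℂ) ^ α * ψ (y / x) := by
    intro x hx y hy
    have hx0 : 0 < x := ha.trans hx
    have hxc : (x : ℂ) ≠ 0 := by exact_mod_cast hx0.ne'
    rw [hhom.eq_cpow_mul_left hx0 hy.le, hψdef]
    simp only [mul_sub, Finset.mul_sum]
    rw [eq_comm, add_sub_left_comm, add_eq_left, sub_eq_zero]
    refine Finset.sum_congr rfl fun j _ => ?_
    rw [Complex.cpow_sub _ _ hxc, Complex.cpow_natCast]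
    push_cast
    rw [div_pow]
    ring
  have hf' : ∀ x, a < x → deriv (fun t => f (x, t)) y₀ =
      ∑ j ∈ Finset.range (m + 1), d j * (j * (y₀ : ℂ) ^ (j - 1)) * (x : ℂ) ^ (α - j) +
        (x : ℂ) ^ (α - 1) * ψ' (y₀ / x) := by
    intro x hx
    have hx0 : 0 < x := ha.trans hx
    have hxc : (x : ℂ) ≠ 0 := by exact_mod_cast hx0.ne'
    have h1 := ((hψ (y₀ / x) (div_pos hy₀ hx0)).scomp y₀
      ((hasDerivAt_id y₀).div_const x)).const_mul ((x : ℂ) ^ α)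
    have h2 : HasDerivAt (fun y : ℝ => ∑ j ∈ Finset.range (m + 1),
        d j * (y : ℂ) ^ j * (x : ℂ) ^ (α - j)) _ y₀ :=
      HasDerivAt.fun_sum fun j _ =>
        (((hasDerivAt_id y₀).ofReal_comp.pow j).const_mul (d j)).mul_const ((x : ℂ) ^ (α - j))
    have h3 : HasDerivAt (fun t => f (x, t)) _ y₀ := (h2.add h1).congr_of_eventuallyEq <| by
      filter_upwards [Ioi_mem_nhds hy₀] with y hy using hf x hx y hy
    refine (h3.congr_deriv ?_).deriv
    rw [Complex.cpow_sub _ _ hxc, Complex.cpow_one, Complex.real_smul]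
    push_cast
    congr 1
    · simp
    · field_simp
  refine ⟨_, _, fun y hy => hasExpPolyLim_integral_of_eq_sum_add ha hP (hint y hy)
    fun x hx => hf x hx y hy.1, hasExpPolyLim_integral_of_eq_sum_add ha hP hint' hf', ?_⟩
  refine HasDerivAt.add (HasDerivAt.fun_sum fun j _ => ?_) hder
  simpa using (((hasDerivAt_id y₀).ofReal_comp.pow j).const_mul (d j)).mul_const (P j)

/-- Integrals over `(1 / R, 1)` of an integrable function converge as `R → ∞`. -/
theorem hasExpPolyLim_integral_inv {g : ℝ → ℂ} (hg : IntervalIntegrable g volume 0 1) :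
    HasExpPolyLim (fun R => ∫ x in R⁻¹..1, g x) (∫ x in (0 : ℝ)..1, g x) := by
  refine .of_tendsto ?_
  have h1 : IntegrableOn g (Set.uIcc 0 1) := by
    rw [Set.uIcc_of_le zero_le_one, integrableOn_Icc_iff_integrableOn_Ioc]
    exact (intervalIntegrable_iff_integrableOn_Ioc_of_le zero_le_one).1 hg
  have h2 := intervalIntegral.continuousOn_primitive_interval_left h1 0 Set.left_mem_uIcc
  rw [Set.uIcc_of_le zero_le_one] at h2
  have h3 : Tendsto (fun e => ∫ x in e..1, g x) (nhdsWithin 0 (Set.Ioi 0))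
      (nhds (∫ x in (0 : ℝ)..1, g x)) :=
    h2.tendsto.mono_left (nhdsWithin_le_of_mem (Icc_mem_nhdsGT zero_lt_one))
  exact h3.comp tendsto_inv_atTop_nhdsGT_zero

theorem exists_hasExpPolyLim_integral_zero {f : ℝ × ℝ → ℂ} {α : ℂ}
    (hsm : ContDiffOn ℝ (⊤ : ℕ∞) f Qset) (hhom : Homog f α) {y₀ : ℝ} (hy₀ : 0 < y₀) :
    ∃ (F : ℝ → ℂ) (G : ℂ),
      (∀ y, 0 < y → HasExpPolyLim (fun R => ∫ x in R⁻¹..1, f (x, y)) (F y)) ∧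
      HasExpPolyLim (fun R => ∫ x in R⁻¹..1, deriv (fun t => f (x, t)) y₀) G ∧
      HasDerivAt F G y₀ := by
  have hχ := contDiffOn_fst_of_Qset hsm
  set χ : ℝ → ℂ := fun t => f (t, 1)
  set χ' : ℝ → ℂ := derivWithin χ (Set.Ici 0) with hχ'def
  have hχ' : ContinuousOn χ' (Set.Ici 0) := (contDiffOn_derivWithin_Ici hχ).continuousOn
  set k : ℝ → ℝ → ℂ := fun y x => (α * (y : ℂ) ^ (α - 1)) * χ (x / y) +
    (y : ℂ) ^ α * ((-x / y ^ 2 : ℝ) * χ' (x / y)) with hk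
  have hkder : ∀ x, 0 < x → ∀ y, 0 < y → HasDerivAt (fun t => f (x, t)) (k y x) y := by
    intro x hx y hy
    have h3 : (fun t => f (x, t)) =ᶠ[nhds y] fun t => (t : ℂ) ^ α * χ (x / t) := by
      filter_upwards [Ioi_mem_nhds hy] with t ht using hhom.eq_cpow_mul_right hx.le ht
    refine HasDerivAt.congr_of_eventuallyEq ?_ h3
    have h1 : HasDerivAt (fun t : ℝ => (t : ℂ) ^ α) (α * (y : ℂ) ^ (α - 1)) y := by
      rcases eq_or_ne α 0 with rfl | hα
      · simpa using hasDerivAt_const y (1 : ℂ)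
      · exact hasDerivAt_ofReal_cpow_const hy.ne' hα
    have h2 : HasDerivAt (fun t : ℝ => x / t) (-x / y ^ 2) y := by
      simpa using (hasDerivAt_const y x).fun_div (hasDerivAt_id y) hy.ne'
    refine (h1.mul ((hasDerivAt_derivWithin_Ici hχ (div_pos hx hy)).scomp y h2)).congr_deriv ?_
    simp [hk, hχ'def]
  have hkc : ContinuousOn (fun p : ℝ × ℝ => k p.1 p.2) (Set.Ioi 0 ×ˢ Set.Ici 0) := by
    have hdiv : ContinuousOn (fun p : ℝ × ℝ => p.2 / p.1) (Set.Ioi 0 ×ˢ Set.Ici 0) :=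
      continuousOn_snd.div continuousOn_fst fun p hp => (Set.mem_Ioi.1 hp.1).ne'
    have hmaps : Set.MapsTo (fun p : ℝ × ℝ => p.2 / p.1) (Set.Ioi 0 ×ˢ Set.Ici 0) (Set.Ici 0) :=
      fun p hp => Set.mem_Ici.2 (div_nonneg hp.2 (Set.mem_Ioi.1 hp.1).le)
    have hpow : ∀ β : ℂ, ContinuousOn (fun p : ℝ × ℝ => (p.1 : ℂ) ^ β)
        (Set.Ioi 0 ×ˢ Set.Ici 0) := fun β p hp =>
      (ContinuousAt.comp (f := Prod.fst) (x := p)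
        (Complex.continuousAt_ofReal_cpow_const p.1 β (Or.inr (Set.mem_Ioi.1 hp.1).ne'))
        continuousAt_fst).continuousWithinAt
    refine ((continuousOn_const.mul (hpow _)).mul (hχ.continuousOn.comp hdiv hmaps)).add
      ((hpow _).mul (ContinuousOn.mul ?_ (hχ'.comp hdiv hmaps)))
    refine Complex.continuous_ofReal.comp_continuousOn
      (continuousOn_snd.neg.div (continuousOn_fst.pow 2) fun p hp => ?_)
    exact pow_ne_zero 2 (Set.mem_Ioi.1 hp.1).ne'
  have hfint : ∀ y, 0 < y → IntervalIntegrable (fun x => f (x, y)) volume 0 1 := by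
    intro y hy
    refine ContinuousOn.intervalIntegrable_of_Icc zero_le_one ?_
    refine hsm.continuousOn.comp (by fun_prop) fun x hx => ⟨⟨hx.1, hy.le⟩, ?_⟩
    simp [hy.ne']
  have hkint : IntervalIntegrable (k y₀) volume 0 1 := by
    refine ContinuousOn.intervalIntegrable_of_Icc zero_le_one ?_
    exact hkc.comp (f := fun x => (y₀, x)) (by fun_prop) fun x hx => ⟨hy₀, hx.1⟩
  obtain ⟨B, hB⟩ := ((isCompact_Icc (a := y₀ / 2) (b := 2 * y₀)).prod
    (isCompact_Icc (a := (0 : ℝ)) (b := 1))).exists_bound_of_continuousOn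
    (hkc.mono (Set.prod_mono (fun y hy => (half_pos hy₀).trans_le hy.1) Set.Icc_subset_Ici_self))
  have hder := intervalIntegral.hasDerivAt_integral_of_dominated_loc_of_deriv_le
    (μ := volume) (a := 0) (b := 1) (F := fun y x => f (x, y)) (F' := k) (x₀ := y₀)
    (s := Set.Icc (y₀ / 2) (2 * y₀)) (bound := fun _ => B)
    (Icc_mem_nhds (by linarith) (by linarith))
    (by
      filter_upwards [Ioi_mem_nhds hy₀] with y hy
      exact (intervalIntegrable_iff.1 (hfint y hy)).aestronglyMeasurable)
    (hfint y₀ hy₀) (intervalIntegrable_iff.1 hkint).aestronglyMeasurable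
    (ae_of_all _ fun x hx y hy => by
      rw [Set.uIoc_of_le zero_le_one] at hx
      exact hB (y, x) ⟨hy, hx.1.le, hx.2⟩)
    intervalIntegrable_const
    (ae_of_all _ fun x hx y hy => by
      rw [Set.uIoc_of_le zero_le_one] at hx
      exact hkder x hx.1 y ((half_pos hy₀).trans_le hy.1))
  refine ⟨_, _, fun y hy => hasExpPolyLim_integral_inv (hfint y hy),
    (hasExpPolyLim_integral_inv hkint).congr' ?_, hder.2⟩
  filter_upwards [eventually_gt_atTop 0] with R hR
  refine intervalIntegral.integral_congr_ae (ae_of_all _ fun x hx => ?_)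
  exact ((hkder x ((lt_min (inv_pos.2 hR) zero_lt_one).trans hx.1) y₀ hy₀).deriv).symm

/-- Lemma `LLimitExchange`, second formula: differentiation under the regularized
integral. Here `F y = ⨍_a^∞ f(x,y) dx` and `G y = ⨍_a^∞ ∂_y f(x,y) dx`; the conclusion
is `F' = G` on `(0,∞)`. -/
theorem stmt_12 (f : ℝ × ℝ → ℂ) (α : ℂ)
    (hsm : ContDiffOn ℝ (⊤ : ℕ∞) f Qset) (hhom : Homog f α)
    (a : ℝ) (ha : 0 ≤ a)
    (F G : ℝ → ℂ)
    (hF : ∀ y : ℝ, 0 < y → HasRegInt (fun x => f (x, y)) a (F y))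
    (hG : ∀ y : ℝ, 0 < y → HasRegInt (fun x => deriv (fun t => f (x, t)) y) a (G y)) :
    ∀ y : ℝ, 0 < y → HasDerivAt F (G y) y := by
  intro y₀ hy₀
  have hnhds : Set.Ioo 0 (2 * y₀) ∈ nhds y₀ := Ioo_mem_nhds hy₀ (by linarith)
  rcases eq_or_ne a 0 with rfl | ha0
  · obtain ⟨F₀, G₀, hF₀, hG₀, hd₀⟩ := exists_hasExpPolyLim_integral_zero hsm hhom hy₀
    obtain ⟨F₁, G₁, hF₁, hG₁, hd₁⟩ :=
      exists_hasExpPolyLim_integral_top hsm hhom zero_lt_one hy₀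
    have hGeq : G y₀ = G₀ + G₁ := by
      obtain ⟨h, -⟩ | ⟨-, v₀, v₁, h₀, h₁, hv⟩ := hG y₀ hy₀
      · exact absurd rfl h
      · rw [hv, h₀.hasExpPolyLim.unique hG₀, h₁.hasExpPolyLim.unique hG₁]
    rw [hGeq]
    refine (hd₀.add hd₁).congr_of_eventuallyEq ?_
    filter_upwards [hnhds] with y hy
    obtain ⟨h, -⟩ | ⟨-, v₀, v₁, h₀, h₁, hv⟩ := hF y hy.1
    · exact absurd rfl h
    · rw [hv, h₀.hasExpPolyLim.unique (hF₀ y hy.1), h₁.hasExpPolyLim.unique (hF₁ y hy),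
        Pi.add_apply]
  · obtain ⟨F₁, G₁, hF₁, hG₁, hd₁⟩ :=
      exists_hasExpPolyLim_integral_top hsm hhom (lt_of_le_of_ne ha ha0.symm) hy₀
    have hGeq : G y₀ = G₁ := by
      obtain ⟨-, h⟩ | ⟨h, -⟩ := hG y₀ hy₀
      · exact h.hasExpPolyLim.unique hG₁
      · exact absurd h ha0
    rw [hGeq]
    refine hd₁.congr_of_eventuallyEq ?_
    filter_upwards [hnhds] with y hy
    obtain ⟨-, h⟩ | ⟨h, -⟩ := hF y hy.1
    · exact h.hasExpPolyLim.unique (hF₁ y hy)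
    · exact absurd h ha0
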